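/- Under hypothesis (H), fix a geodesic ray γ from o and c ∈ ℕ, let Γ_c = {x ∈ S : ∃ n, d(x, γ(n)) ≤ c} be the non-tangential tube of width c, let U ⊆ S contain Γ_c, let τ = inf{n ≥ 0 : X_n ∉ U}, and let G_U(o,y) = ∑_{n=0}^∞ P_o[X_n = y and n < τ]. Then for every sequence (y_j) in Γ_c with d(o, y_j) → ∞, the ratios G_U(o,y_j)/G(o,y_j) converge to P^K_o[τ = ∞], the probability under the Doob-transformed chain started at o that the chain never leaves U. -/

import Mathlib

open MeasureTheory Filter
open scoped Classical ENNReal Topology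

noncomputable section

/-- The `n`-step transition probabilities of the nearest-neighbour walk with
one-step transition probabilities `p`. -/
def pn {S : Type*} (p : S → S → ℝ) : ℕ → S → S → ℝ
  | 0, x, y => if x = y then 1 else 0
  | n + 1, x, y => ∑' z, p x z * pn p n z y

/-- The Green function `G(x,y) = ∑_n p_n(x,y)`. -/
def green {S : Type*} (p : S → S → ℝ) (x y : S) : ℝ := ∑' n, pn p n x y

/-- The exit time from `U` of the trajectory `ω`, valued in `ℕ∞`. -/
def exitTime {S : Type*} (U : Set S) (ω : ℕ → S) : ℕ∞ :=
  ⨅ (n : ℕ) (_ : ω n ∉ U), (n : ℕ∞)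
namespace RatioAux

set_option linter.unusedSectionVars false

section tree
variable {S : Type*} {G : SimpleGraph S}

lemma closer_unique (hconn : G.Connected) (hacyc : G.IsAcyclic) {x a b y : S}
    (ha : G.Adj x a) (hb : G.Adj x b)
    (hay : G.dist a y < G.dist x y) (hby : G.dist b y < G.dist x y) : a = b := by
  have key : ∀ a, G.Adj x a → G.dist a y < G.dist x y →
      ∃ q : G.Walk x y, q.IsPath ∧ q.snd = a := by
    intro a ha hay
    obtain ⟨q, hq, hql⟩ := hconn.exists_path_of_dist a y
    refine ⟨SimpleGraph.Walk.cons ha q, ?_, by simp⟩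
    rw [SimpleGraph.Walk.cons_isPath_iff]
    refine ⟨hq, fun hx => ?_⟩
    have h1 : G.dist x y ≤ (q.dropUntil x hx).length := SimpleGraph.dist_le _
    have h2 := q.length_dropUntil_le_length hx
    omega
  obtain ⟨q, hq, hqa⟩ := key a ha hay
  obtain ⟨r, hr, hrb⟩ := key b hb hby
  have := (hacyc.subsingleton_path x y).elim ⟨q, hq⟩ ⟨r, hr⟩
  have h : q = r := congrArg Subtype.val this
  rw [← hqa, ← hrb, h]

lemma exists_closer (hconn : G.Connected) {x y : S} (h : x ≠ y) :
    ∃ a, G.Adj x a ∧ G.dist a y + 1 = G.dist x y := by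
  obtain ⟨q, hq, hql⟩ := hconn.exists_path_of_dist x y
  cases q with
  | nil => exact absurd rfl h
  | @cons _ v _ ha q =>
    refine ⟨v, ha, ?_⟩
    have h1 := SimpleGraph.dist_le q
    have h2 : G.dist x y ≤ G.dist x v + G.dist v y := hconn.dist_triangle
    have h3 := SimpleGraph.dist_eq_one_iff_adj.mpr ha
    rw [h3] at h2
    simp at hql
    omega

lemma dist_adj (hconn : G.Connected) (hacyc : G.IsAcyclic) {x a : S} (y : S) (ha : G.Adj x a) :
    G.dist a y = G.dist x y + 1 ∨ G.dist x y = G.dist a y + 1 := by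
  have ht : G.IsTree := ⟨hconn, hacyc⟩
  have := ht.dist_eq_dist_add_one_of_adj y ha
  rw [SimpleGraph.dist_comm (u := y), SimpleGraph.dist_comm (u := y)] at this
  tauto

/-- crossing the edge `a b`. -/
lemma edge_cross (hconn : G.Connected) (hacyc : G.IsAcyclic) {a b x x' : S} (hab : G.Adj a b)
    (hx : G.Adj x x') (h1 : G.dist x a < G.dist x b) (h2 : G.dist x' b < G.dist x' a) :
    x = a := by
  by_contra hne
  have e1 := dist_adj hconn hacyc a hx
  have e2 := dist_adj hconn hacyc b hx
  have e3 := dist_adj hconn hacyc x hab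
  have e4 := dist_adj hconn hacyc x' hab
  obtain ⟨w, hw, hwd⟩ := exists_closer hconn (Ne.symm hne)
  have e5 := dist_adj hconn hacyc w hx
  rw [SimpleGraph.dist_comm (u := a) (v := x), SimpleGraph.dist_comm (u := b) (v := x)] at e3
  rw [SimpleGraph.dist_comm (u := a) (v := x'), SimpleGraph.dist_comm (u := b) (v := x')] at e4
  rw [SimpleGraph.dist_comm (u := x) (v := w), SimpleGraph.dist_comm (u := x') (v := w)] at e5
  have c1 := SimpleGraph.dist_comm (G := G) (u := a) (v := x)
  have c2 := SimpleGraph.dist_comm (G := G) (u := a) (v := x')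
  have c3 := SimpleGraph.dist_comm (G := G) (u := b) (v := x)
  have c4 := SimpleGraph.dist_comm (G := G) (u := b) (v := x')
  have : w = b := closer_unique hconn hacyc hw hab (y := x') (by omega) (by omega)
  subst this
  omega

section ray
variable (hconn : G.Connected) (hacyc : G.IsAcyclic) {γ : ℕ → S}
    (hγ : ∀ m n : ℕ, (G.dist (γ m) (γ n) : ℤ) = |(m : ℤ) - (n : ℤ)|)
    {k : S → ℕ}
    (hk_min : ∀ (x : S) (n : ℕ), G.dist x (γ (k x)) ≤ G.dist x (γ n))
    (hk_uniq : ∀ (x : S) (n : ℕ), G.dist x (γ n) ≤ G.dist x (γ (k x)) → n = k x)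
include hconn hacyc hγ

lemma ray_adj (n : ℕ) : G.Adj (γ n) (γ (n + 1)) := by
  rw [← SimpleGraph.dist_eq_one_iff_adj]
  have := hγ n (n + 1)
  push_cast at this
  have h2 : |(n : ℤ) - (n + 1)| = 1 := by
    rw [show (n : ℤ) - (n + 1) = -1 by ring]; rfl
  omega

lemma ray_inj {m n : ℕ} (h : γ m = γ n) : m = n := by
  have := hγ m n
  rw [h, SimpleGraph.dist_self] at this
  have := abs_eq_zero.mp this.symm
  omega

include hk_min hk_uniq

lemma k_ray (n : ℕ) : k (γ n) = n := by
  symm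
  apply hk_uniq
  simp

lemma dist_up (x : S) (j : ℕ) : G.dist x (γ (k x + j)) < G.dist x (γ (k x + j + 1)) := by
  induction j with
  | zero =>
    by_contra h
    have := hk_uniq x (k x + 1) (by simpa using h)
    omega
  | succ j ih =>
    by_contra h
    have a1 := ray_adj hconn hacyc hγ (k x + j)
    have a2 := ray_adj hconn hacyc hγ (k x + j + 1)
    have := dist_adj hconn hacyc x a2
    have c := fun n => SimpleGraph.dist_comm (G := G) (u := γ n) (v := x)
    have c1 := c (k x + j)
    have c2 := c (k x + j + 1)
    have c3 := c (k x + j + 1 + 1)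
    have e : γ (k x + j) = γ (k x + j + 1 + 1) :=
      closer_unique hconn hacyc a1.symm a2 (y := x) (by omega) (by
        rw [← add_assoc] at h; omega)
    have := ray_inj hconn hacyc hγ e
    omega

lemma dist_down (x : S) (j i : ℕ) (hi : i + j + 1 = k x) :
    G.dist x (γ (i + 1)) < G.dist x (γ i) := by
  induction j generalizing i with
  | zero =>
    by_contra h
    have := hk_uniq x i (by rw [← hi]; simpa using h)
    omega
  | succ j ih =>
    have ih := ih (i + 1) (by omega)
    by_contra h
    have a1 := ray_adj hconn hacyc hγ i
    have a2 := ray_adj hconn hacyc hγ (i + 1)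
    have := dist_adj hconn hacyc x a1
    have c := fun n => SimpleGraph.dist_comm (G := G) (u := γ n) (v := x)
    have c1 := c i
    have c2 := c (i + 1)
    have c3 := c (i + 1 + 1)
    have e : γ i = γ (i + 1 + 1) :=
      closer_unique hconn hacyc a1.symm a2 (y := x) (by omega) (by omega)
    have := ray_inj hconn hacyc hγ e
    omega

lemma side_iff (x : S) (m : ℕ) : k x ≤ m ↔ G.dist x (γ m) < G.dist x (γ (m + 1)) := by
  constructor
  · intro h
    obtain ⟨j, rfl⟩ := Nat.exists_eq_add_of_le h
    exact dist_up hconn hacyc hγ hk_min hk_uniq x j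
  · intro h
    by_contra hlt
    have := dist_down hconn hacyc hγ hk_min hk_uniq x (k x - m - 1) m (by omega)
    omega

/-- leaving `{k ≤ m}` happens only at `γ m`. -/
lemma side_cross {x x' : S} {m : ℕ} (hx : G.Adj x x') (h : k x ≤ m) (h' : ¬ k x' ≤ m) :
    x = γ m := by
  rw [side_iff hconn hacyc hγ hk_min hk_uniq] at h h'
  have a := ray_adj hconn hacyc hγ m
  have := dist_adj hconn hacyc x' a
  have c1 := SimpleGraph.dist_comm (G := G) (u := γ m) (v := x')
  have c2 := SimpleGraph.dist_comm (G := G) (u := γ (m + 1)) (v := x')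
  exact edge_cross hconn hacyc a hx h (by omega)

end ray
end tree

section cyl
variable {S : Type*}

/-- weight of staying in `U` for times `< n` and being at `w` at time `n`. -/
def T (U : Set S) (r : S → S → ℝ≥0∞) : ℕ → S → S → ℝ≥0∞
  | 0, x, w => if x = w then 1 else 0
  | n + 1, x, w => if x ∈ U then ∑' z, r x z * T U r n z w else 0

lemma cyl_T [Countable S] [MeasurableSpace S] [MeasurableSingletonClass S]
    (U : Set S) (r : S → S → ℝ≥0∞) (Q : Measure (ℕ → S))
    (hQ : ∀ n (f : ℕ → S), Q {ω | ∀ j ≤ n + 1, ω j = f j} =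
      Q {ω | ∀ j ≤ n, ω j = f j} * r (f n) (f (n + 1))) (w : S) (m n : ℕ) (f : ℕ → S) :
    Q {ω | (∀ j ≤ n, ω j = f j) ∧ (∀ j < m, ω (n + j) ∈ U) ∧ ω (n + m) = w} =
      Q {ω | ∀ j ≤ n, ω j = f j} * T U r m (f n) w := by
  induction m generalizing n f with
  | zero =>
    by_cases h : f n = w
    · simp only [T, h, if_true, mul_one]
      congr 1
      ext ω
      simp only [Set.mem_ofPred_eq]
      constructor
      · exact fun h => h.1
      · exact fun h' => ⟨h', by simp, by simpa [← h] using h' n le_rfl⟩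
    · simp only [T, h, if_false, mul_zero]
      convert measure_empty (μ := Q)
      ext ω
      simp only [Set.mem_ofPred_eq, Set.mem_empty_iff_false, iff_false]
      rintro ⟨h1, -, h2⟩
      exact h (by rw [← h1 n le_rfl]; simpa using h2)
  | succ m ih =>
    by_cases h : f n ∈ U
    · have hset : {ω : ℕ → S | (∀ j ≤ n, ω j = f j) ∧ (∀ j < m + 1, ω (n + j) ∈ U) ∧
          ω (n + (m + 1)) = w} = ⋃ z : S, {ω | (∀ j ≤ n + 1, ω j = Function.update f (n + 1) z j) ∧
            (∀ j < m, ω (n + 1 + j) ∈ U) ∧ ω (n + 1 + m) = w} := by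
        ext ω
        simp only [Set.mem_ofPred_eq, Set.mem_iUnion]
        constructor
        · rintro ⟨h1, h2, h3⟩
          refine ⟨ω (n + 1), ?_, ?_, ?_⟩
          · intro j hj
            rcases Nat.lt_or_ge j (n + 1) with hj' | hj'
            · rw [Function.update_of_ne (by omega)]; exact h1 j (by omega)
            · have : j = n + 1 := by omega
              subst this; simp
          · intro j hj
            have := h2 (j + 1) (by omega)
            rwa [show n + 1 + j = n + (j + 1) by omega]
          · rwa [show n + 1 + m = n + (m + 1) by omega]
        · rintro ⟨z, h1, h2, h3⟩
          have h1' : ∀ j ≤ n, ω j = f j := fun j hj => by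
            rw [h1 j (by omega), Function.update_of_ne (by omega)]
          refine ⟨h1', ?_, ?_⟩
          · intro j hj
            rcases j with _ | j
            · rw [add_zero, h1' n le_rfl]; exact h
            · have := h2 j (by omega)
              rwa [show n + (j + 1) = n + 1 + j by omega]
          · rwa [show n + (m + 1) = n + 1 + m by omega]
      have hmeas : ∀ j (s : S), MeasurableSet {ω : ℕ → S | ω j = s} := fun j s =>
        measurableSet_eq_fun (measurable_pi_apply j) measurable_const
      rw [hset, measure_iUnion]
      · simp_rw [ih]
        simp only [T, h, if_true]
        rw [← ENNReal.tsum_mul_left]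
        congr 1
        ext z
        rw [hQ]
        have : {ω : ℕ → S | ∀ j ≤ n, ω j = Function.update f (n + 1) z j} =
            {ω | ∀ j ≤ n, ω j = f j} := by
          ext ω
          simp only [Set.mem_ofPred_eq]
          refine forall₂_congr fun j hj => ?_
          rw [Function.update_of_ne (by omega)]
        rw [this, Function.update_of_ne (by omega), Function.update_self, mul_assoc]
      · intro z z' hz
        rw [Function.onFun, Set.disjoint_left]
        rintro ω ⟨h1, -⟩ ⟨h2, -⟩
        apply hz
        have e1 := h1 (n + 1) le_rfl
        have e2 := h2 (n + 1) le_rfl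
        simp at e1 e2
        rw [← e1, ← e2]
      · intro z
        have hU : ∀ j, MeasurableSet {ω : ℕ → S | ω j ∈ U} := fun j =>
          measurable_pi_apply j (Set.to_countable U).measurableSet
        refine MeasurableSet.inter ?_ (MeasurableSet.inter ?_ (hmeas _ _))
        · show MeasurableSet {ω : ℕ → S | ∀ j ≤ n + 1, ω j = Function.update f (n + 1) z j}
          simp only [Set.ofPred_forall]
          exact MeasurableSet.iInter fun j => MeasurableSet.iInter fun _ => hmeas _ _
        · show MeasurableSet {ω : ℕ → S | ∀ j < m, ω (n + 1 + j) ∈ U}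
          simp only [Set.ofPred_forall]
          exact MeasurableSet.iInter fun j => MeasurableSet.iInter fun _ => hU _
    · simp only [T, h, if_false, mul_zero]
      convert measure_empty (μ := Q)
      ext ω
      simp only [Set.mem_ofPred_eq, Set.mem_empty_iff_false, iff_false]
      rintro ⟨h1, h2, -⟩
      exact h (by rw [← h1 n le_rfl]; simpa using h2 0 (by omega))

lemma path_T [Countable S] [MeasurableSpace S] [MeasurableSingletonClass S]
    (U : Set S) (r : S → S → ℝ≥0∞) (Q : Measure (ℕ → S)) [IsProbabilityMeasure Q] (o : S)
    (hQ0 : Q {ω | ω 0 = o} = 1)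
    (hQ : ∀ n (f : ℕ → S), Q {ω | ∀ j ≤ n + 1, ω j = f j} =
      Q {ω | ∀ j ≤ n, ω j = f j} * r (f n) (f (n + 1))) (w : S) (m : ℕ) :
    Q {ω | (∀ j < m, ω j ∈ U) ∧ ω m = w} = T U r m o w := by
  have h := cyl_T U r Q hQ w m 0 (fun _ => o)
  have hmeas : MeasurableSet {ω : ℕ → S | ω 0 = o} :=
    measurableSet_eq_fun (measurable_pi_apply 0) measurable_const
  have h0 : {ω : ℕ → S | ∀ j ≤ 0, ω j = o} = {ω | ω 0 = o} := by ext; simp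
  simp only [h0, hQ0, one_mul, zero_add] at h
  rw [← h]
  have hae : ∀ᵐ ω ∂Q, ω 0 = o := by
    rw [← prob_compl_eq_zero_iff hmeas] at hQ0
    exact hQ0
  apply measure_congr
  filter_upwards [hae] with ω hω
  apply propext
  show ((∀ j < m, ω j ∈ U) ∧ ω m = w) ↔ ((∀ j ≤ 0, ω j = o) ∧ (∀ j < m, ω j ∈ U) ∧ ω m = w)
  simp [hω]

/-- h-transform -/
lemma T_doob (U : Set S) (r r' : S → S → ℝ≥0∞) (K : S → ℝ≥0∞) (hK0 : ∀ x, K x ≠ 0)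
    (hKt : ∀ x, K x ≠ ⊤) (hr : ∀ x y, r' x y = r x y * K y / K x) (n : ℕ) (x w : S) :
    T U r' n x w = T U r n x w * K w / K x := by
  induction n generalizing x with
  | zero =>
    by_cases h : x = w
    · subst h; simp [T, ENNReal.div_self (hK0 x) (hKt x)]
    · simp [T, h]
  | succ n ih =>
    by_cases h : x ∈ U
    · simp only [T, h, if_true, ih, hr]
      simp only [div_eq_mul_inv]
      rw [← ENNReal.tsum_mul_right, ← ENNReal.tsum_mul_right]
      congr 1
      ext z
      have : K z * (K z)⁻¹ = 1 := ENNReal.mul_inv_cancel (hK0 z) (hKt z)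
      calc _ = r x z * T U r n z w * K w * (K x)⁻¹ * (K z * (K z)⁻¹) := by ring
        _ = _ := by rw [this, mul_one]
    · simp [T, h]

/-- exit decomposition -/
lemma T_decomp (U : Set S) (r : S → S → ℝ≥0∞) {y : S} (hy : y ∈ U) (n : ℕ) (x : S) :
    T Set.univ r n x y = T U r n x y + ∑ i ∈ Finset.range (n + 1),
      ∑' w : S, (if w ∈ U then 0 else T U r i x w) * T Set.univ r (n - i) w y := by
  by_cases hx : x ∈ U
  · induction n generalizing x with
    | zero =>
      have : ∀ w : S, (if w ∈ U then 0 else T U r 0 x w) = 0 := by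
        intro w
        split_ifs with hw
        · rfl
        · simp only [T]; rw [if_neg]; rintro rfl; exact hw hx
      rw [zero_add, Finset.sum_range_one]
      simp only [this, zero_mul, tsum_zero, add_zero]
      rfl
    | succ n ih =>
      have h0 : ∀ w : S, (if w ∈ U then 0 else T U r 0 x w) = 0 := by
        intro w
        split_ifs with hw
        · rfl
        · simp only [T]; rw [if_neg]; rintro rfl; exact hw hx
      have hall : ∀ z, T Set.univ r n z y = T U r n z y + ∑ i ∈ Finset.range (n + 1),
          ∑' w : S, (if w ∈ U then 0 else T U r i z w) * T Set.univ r (n - i) w y := by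
        intro z
        by_cases hz : z ∈ U
        · exact ih z hz
        · have hT : ∀ n, T U r n z y = 0 := by
            intro n; cases n with
            | zero => simp only [T]; rw [if_neg]; rintro rfl; exact hz hy
            | succ n => simp [T, hz]
          rw [hT, zero_add, Finset.sum_range_succ', Finset.sum_eq_zero, zero_add,
            tsum_eq_single z]
          · simp [T, hz]
          · intro w hw; simp [T, hw.symm]
          · intro i _; simp [T, hz]
      rw [Finset.sum_range_succ']
      simp only [h0, zero_mul, tsum_zero, add_zero]
      rw [T, if_pos (Set.mem_univ x), T, if_pos hx]
      conv_lhs => enter [1, z]; rw [hall z, mul_add]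
      rw [ENNReal.tsum_add]
      congr 1
      simp only [Finset.mul_sum]
      rw [Summable.tsum_finsetSum (fun _ _ => ENNReal.summable)]
      apply Finset.sum_congr rfl
      intro i hi
      simp only [← ENNReal.tsum_mul_left]
      rw [ENNReal.tsum_comm]
      congr 1
      ext w
      rw [Nat.add_sub_add_right]
      by_cases hw : w ∈ U
      · simp [hw]
      · simp only [hw, if_false, T, hx, if_true]
        rw [← ENNReal.tsum_mul_right]
        congr 1; ext z; ring
  · have hT : T U r n x y = 0 := by
      cases n with
      | zero => simp only [T]; rw [if_neg]; rintro rfl; exact hx hy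
      | succ n => simp [T, hx]
    rw [hT, zero_add, Finset.sum_range_succ', Finset.sum_eq_zero, zero_add,
      tsum_eq_single x]
    · simp [T, hx]
    · intro w hw; simp [T, hw.symm]
    · intro i _; simp [T, hx]

lemma cauchy (a b : ℕ → ℝ≥0∞) :
    ∑' n, ∑ i ∈ Finset.range (n + 1), a i * b (n - i) = (∑' n, a n) * ∑' n, b n := by
  have h1 : ∀ n, ∑ i ∈ Finset.range (n + 1), a i * b (n - i) =
      ∑ q ∈ Finset.HasAntidiagonal.antidiagonal n, a q.1 * b q.2 := fun n =>
    (Finset.Nat.sum_antidiagonal_eq_sum_range_succ (fun i j => a i * b j) n).symm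
  simp_rw [h1, ← ENNReal.tsum_mul_right, ← ENNReal.tsum_mul_left]
  rw [← ENNReal.tsum_prod (f := fun i j => a i * b j),
    ← Finset.HasAntidiagonal.sigmaAntidiagonalEquivProd.tsum_eq (fun q : ℕ × ℕ => a q.1 * b q.2),
    ENNReal.tsum_sigma']
  congr 1
  ext n
  rw [tsum_fintype, ← Finset.sum_coe_sort]
  rfl

lemma green_decomp (U : Set S) (r : S → S → ℝ≥0∞) {y : S} (hy : y ∈ U) (x : S) :
    ∑' n, T Set.univ r n x y = ∑' n, T U r n x y +
      ∑' w : S, (if w ∈ U then 0 else ∑' n, T U r n x w) * ∑' n, T Set.univ r n w y := by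
  conv_lhs => enter [1, n]; rw [T_decomp U r hy n x]
  rw [ENNReal.tsum_add]
  congr 1
  simp_rw [← Summable.tsum_finsetSum (fun _ _ => ENNReal.summable)]
  rw [ENNReal.tsum_comm]
  congr 1
  ext w
  rw [cauchy (fun i => if w ∈ U then 0 else T U r i x w) (fun i => T Set.univ r i w y)]
  split_ifs <;> simp

end cyl

section green
variable {S : Type*} {G : SimpleGraph S} [∀ x : S, Fintype (G.neighborSet x)] {p : S → S → ℝ}

lemma phi_exists (hconn : G.Connected) (hacyc : G.IsAcyclic)
    (hp_sum : ∀ x, ∑ y ∈ G.neighborFinset x, p x y = 1)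
    {η : ℝ} (hη : 0 < η) (hη' : η < 1 / 2)
    (hH : ∀ x y, G.Adj x y → p x y ≤ 1 / 2 - η) :
    ∃ l ρ : ℝ, 0 < l ∧ l < 1 ∧ 0 < ρ ∧ ρ < 1 ∧ ∀ y x,
      ∑ z ∈ G.neighborFinset x, p x z * l ^ G.dist z y ≤ ρ * l ^ G.dist x y := by
  set l := 1 - η with hl
  set q := 1 / 2 - η with hq
  have hl0 : 0 < l := by linarith
  have hl1 : l < 1 := by linarith
  have hb : q / l + (1 - q) * l < 1 := by
    have h1 : q + (1 - q) * l * l < l := by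
      rw [hl, hq]; nlinarith [mul_pos hη hη]
    have h2 : q / l + (1 - q) * l = (q + (1 - q) * l * l) / l := by field_simp
    rw [h2, div_lt_one hl0]; exact h1
  refine ⟨l, max l (q / l + (1 - q) * l), hl0, hl1, lt_max_of_lt_left hl0, max_lt hl1 hb, ?_⟩
  intro y x
  have hpow : 0 < l ^ G.dist x y := pow_pos hl0 _
  by_cases hxy : x = y
  · subst hxy
    have : ∑ z ∈ G.neighborFinset x, p x z * l ^ G.dist z x = l := by
      trans (∑ z ∈ G.neighborFinset x, p x z) * l
      swap
      · rw [hp_sum, one_mul]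
      rw [Finset.sum_mul]
      apply Finset.sum_congr rfl
      intro z hz
      have hz : G.Adj x z := by simpa using hz
      rw [SimpleGraph.dist_eq_one_iff_adj.mpr hz.symm, pow_one]
    rw [this]
    simp
  · obtain ⟨a, ha, had⟩ := exists_closer hconn hxy
    have hmem : a ∈ G.neighborFinset x := by simpa using ha
    have hs := hp_sum x
    rw [← Finset.add_sum_erase _ _ hmem] at hs ⊢
    have h2 : ∑ z ∈ (G.neighborFinset x).erase a, p x z * l ^ G.dist z y =
        (1 - p x a) * l ^ (G.dist x y + 1) := by
      rw [← hs, add_sub_cancel_left, Finset.sum_mul]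
      apply Finset.sum_congr rfl
      intro z hz
      rw [Finset.mem_erase] at hz
      have hz2 : G.Adj x z := by simpa using hz.2
      rcases dist_adj hconn hacyc y hz2 with h | h
      · rw [h]
      · exact absurd (closer_unique hconn hacyc hz2 ha (y := y) (by omega) (by omega)) hz.1
    rw [h2, ← had]
    have hpa := hH x a ha
    have hpos : 0 < l ^ G.dist a y := pow_pos hl0 _
    calc p x a * l ^ G.dist a y + (1 - p x a) * l ^ (G.dist a y + 1 + 1)
        = (p x a + (1 - p x a) * l * l) * l ^ G.dist a y := by ring
      _ ≤ (q + (1 - q) * l * l) * l ^ G.dist a y := by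
          apply mul_le_mul_of_nonneg_right _ hpos.le
          nlinarith [mul_nonneg (sub_nonneg.mpr hpa) (by nlinarith : 0 ≤ 1 - l * l)]
      _ = (q / l + (1 - q) * l) * l ^ (G.dist a y + 1) := by rw [pow_succ]; field_simp
      _ ≤ _ := by
          apply mul_le_mul_of_nonneg_right (le_max_right _ _) (by positivity)

variable (hconn : G.Connected) (hp0 : ∀ x y, 0 ≤ p x y)
    (hp_zero : ∀ x y, ¬ G.Adj x y → p x y = 0)
    {l ρ : ℝ} (hl : 0 < l) (hl1 : l < 1) (hρ : 0 < ρ) (hρ1 : ρ < 1)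
    (hφ : ∀ y x, ∑ z ∈ G.neighborFinset x, p x z * l ^ G.dist z y ≤ ρ * l ^ G.dist x y)

include hp_zero in
lemma pn_succ (n : ℕ) (x y : S) :
    pn p (n + 1) x y = ∑ z ∈ G.neighborFinset x, p x z * pn p n z y := by
  rw [pn, tsum_eq_sum]
  intro z hz
  rw [hp_zero x z (by simpa using hz), zero_mul]

include hp_zero hp0 in
lemma pn_nonneg (n : ℕ) (x y : S) : 0 ≤ pn p n x y := by
  induction n generalizing x with
  | zero => simp only [pn]; split_ifs <;> norm_num
  | succ n ih =>
    rw [pn_succ hp_zero]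
    exact Finset.sum_nonneg fun z _ => mul_nonneg (hp0 _ _) (ih z)

include hp_zero hp0 in
lemma ofReal_pn (n : ℕ) (x y : S) :
    ENNReal.ofReal (pn p n x y) = T Set.univ (fun a b => ENNReal.ofReal (p a b)) n x y := by
  induction n generalizing x with
  | zero => simp only [pn, T]; split_ifs <;> simp
  | succ n ih =>
    rw [pn_succ hp_zero, T, if_pos (Set.mem_univ _),
      ENNReal.ofReal_sum_of_nonneg (fun z _ => mul_nonneg (hp0 _ _) (pn_nonneg hp0 hp_zero n z y)),
      tsum_eq_sum (s := G.neighborFinset x)]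
    · apply Finset.sum_congr rfl
      intro z _
      rw [ENNReal.ofReal_mul (hp0 _ _), ih]
    · intro z hz
      rw [hp_zero x z (by simpa using hz)]; simp

include hp_zero hp0 hl hρ hφ

lemma pn_le (n : ℕ) (x y : S) : pn p n x y ≤ ρ ^ n * l ^ G.dist x y := by
  induction n generalizing x with
  | zero =>
    simp only [pn]
    split_ifs with h
    · subst h; simp
    · positivity
  | succ n ih =>
    rw [pn_succ hp_zero]
    calc _ ≤ ∑ z ∈ G.neighborFinset x, p x z * (ρ ^ n * l ^ G.dist z y) :=
          Finset.sum_le_sum fun z _ => mul_le_mul_of_nonneg_left (ih z) (hp0 _ _)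
      _ = ρ ^ n * ∑ z ∈ G.neighborFinset x, p x z * l ^ G.dist z y := by
          rw [Finset.mul_sum]; exact Finset.sum_congr rfl fun z _ => by ring
      _ ≤ ρ ^ n * (ρ * l ^ G.dist x y) := mul_le_mul_of_nonneg_left (hφ y x) (by positivity)
      _ = _ := by ring

include hρ1

lemma pn_summable (x y : S) : Summable (fun n => pn p n x y) :=
  Summable.of_nonneg_of_le (fun n => pn_nonneg hp0 hp_zero n x y)
    (fun n => pn_le hp0 hp_zero hl hρ hφ n x y)
    ((summable_geometric_of_lt_one hρ.le hρ1).mul_right _)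

lemma green_nonneg (x y : S) : 0 ≤ green p x y :=
  tsum_nonneg fun n => pn_nonneg hp0 hp_zero n x y

lemma green_le (x y : S) : green p x y ≤ (1 - ρ)⁻¹ * l ^ G.dist x y := by
  rw [← tsum_geometric_of_lt_one hρ.le hρ1, ← tsum_mul_right]
  exact (pn_summable hp0 hp_zero hl hρ hρ1 hφ x y).tsum_le_tsum
    (fun n => pn_le hp0 hp_zero hl hρ hφ n x y)
    ((summable_geometric_of_lt_one hρ.le hρ1).mul_right _)

lemma green_eq (x y : S) : green p x y =
    (if x = y then 1 else 0) + ∑ z ∈ G.neighborFinset x, p x z * green p z y := by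
  have hs := fun x => pn_summable hp0 hp_zero hl hρ hρ1 hφ x y
  rw [green, (hs x).tsum_eq_zero_add]
  congr 1
  simp_rw [pn_succ hp_zero]
  rw [Summable.tsum_finsetSum (fun z _ => (hs z).mul_left _)]
  apply Finset.sum_congr rfl
  intro z _
  rw [tsum_mul_left, green]

lemma ofReal_green (x y : S) : ENNReal.ofReal (green p x y) =
    ∑' n, T Set.univ (fun a b => ENNReal.ofReal (p a b)) n x y := by
  rw [green, ENNReal.ofReal_tsum_of_nonneg (fun n => pn_nonneg hp0 hp_zero n x y)
    (pn_summable hp0 hp_zero hl hρ hρ1 hφ x y)]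
  simp_rw [ofReal_pn hp0 hp_zero]

lemma sub_zero_of {v : S → ℝ} {C : ℝ} (hC : 0 ≤ C) (y : S)
    (hv : ∀ x, v x ≤ ∑ z ∈ G.neighborFinset x, p x z * v z)
    (hvC : ∀ x, v x ≤ C * l ^ G.dist x y) (x : S) : v x ≤ 0 := by
  have key : ∀ n x, v x ≤ ρ ^ n * (C * l ^ G.dist x y) := by
    intro n
    induction n with
    | zero => simpa using hvC
    | succ n ih =>
      intro x
      calc v x ≤ _ := hv x
        _ ≤ ∑ z ∈ G.neighborFinset x, p x z * (ρ ^ n * (C * l ^ G.dist z y)) :=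
          Finset.sum_le_sum fun z _ => mul_le_mul_of_nonneg_left (ih z) (hp0 _ _)
        _ = ρ ^ n * C * ∑ z ∈ G.neighborFinset x, p x z * l ^ G.dist z y := by
          rw [Finset.mul_sum]; exact Finset.sum_congr rfl fun z _ => by ring
        _ ≤ ρ ^ n * C * (ρ * l ^ G.dist x y) := mul_le_mul_of_nonneg_left (hφ y x) (by positivity)
        _ = _ := by ring
  have ht : Tendsto (fun n : ℕ => ρ ^ n * (C * l ^ G.dist x y)) atTop (𝓝 0) := by
    have := (tendsto_pow_atTop_nhds_zero_of_lt_one hρ.le hρ1).mul_const (C * l ^ G.dist x y)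
    simpa using this
  exact ge_of_tendsto' ht fun n => key n x

include hl1

lemma green_le' (x y : S) : green p x y ≤ (1 - ρ)⁻¹ := by
  have h := green_le hp0 hp_zero hl hρ hρ1 hφ x y
  have h1 : l ^ G.dist x y ≤ 1 := pow_le_one₀ hl.le hl1.le
  have h2 : 0 < (1 - ρ)⁻¹ := inv_pos.mpr (by linarith)
  nlinarith

lemma green_B (x y z : S) : green p x y * green p y z ≤ green p x z * green p y y := by
  have hM : 0 < (1 - ρ)⁻¹ := inv_pos.mpr (by linarith)
  have gn := green_nonneg hp0 hp_zero hl hρ hρ1 hφ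
  set v : S → ℝ := fun x => max (green p x y * green p y z - green p x z * green p y y) 0 with hvdef
  have hv0 : ∀ x, 0 ≤ v x := fun x => le_max_right _ _
  have h : v x ≤ 0 := by
    apply sub_zero_of hp0 hp_zero hl hρ hρ1 hφ (C := (1 - ρ)⁻¹ * (1 - ρ)⁻¹) (by positivity) y
    · intro x
      have hn : 0 ≤ ∑ w ∈ G.neighborFinset x, p x w * v w :=
        Finset.sum_nonneg fun w _ => mul_nonneg (hp0 _ _) (hv0 _)
      apply max_le _ hn
      by_cases hxy : x = y
      · subst hxy; rw [mul_comm, sub_self]; exact hn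
      · have e1 := green_eq hp0 hp_zero hl hρ hρ1 hφ x y
        have e2 := green_eq hp0 hp_zero hl hρ hρ1 hφ x z
        rw [if_neg hxy, zero_add] at e1
        have e3 : ∑ w ∈ G.neighborFinset x, p x w * green p w z ≤ green p x z := by
          rw [e2]; split_ifs <;> linarith
        calc green p x y * green p y z - green p x z * green p y y
            ≤ (∑ w ∈ G.neighborFinset x, p x w * green p w y) * green p y z -
              (∑ w ∈ G.neighborFinset x, p x w * green p w z) * green p y y := by
              rw [← e1]
              have := mul_le_mul_of_nonneg_right e3 (gn y y)
              linarith
          _ = ∑ w ∈ G.neighborFinset x,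
              p x w * (green p w y * green p y z - green p w z * green p y y) := by
              rw [Finset.sum_mul, Finset.sum_mul, ← Finset.sum_sub_distrib]
              exact Finset.sum_congr rfl fun w _ => by ring
          _ ≤ _ := Finset.sum_le_sum fun w _ =>
              mul_le_mul_of_nonneg_left (le_max_left _ _) (hp0 _ _)
    · intro x
      apply max_le _ (by positivity)
      have h1 := green_le hp0 hp_zero hl hρ hρ1 hφ x y
      have h2 := green_le' hp0 hp_zero hl hl1 hρ hρ1 hφ y z
      have := mul_le_mul h1 h2 (gn y z) (by positivity)
      have := mul_nonneg (gn x z) (gn y y)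
      nlinarith
  have := le_max_left (green p x y * green p y z - green p x z * green p y y) 0
  have : green p x y * green p y z - green p x z * green p y y ≤ v x := this
  linarith

lemma green_A {A : Set S} {y z : S} (hz : z ∉ A)
    (hA : ∀ x ∈ A, ∀ x', G.Adj x x' → x' ∈ A ∨ x' = y) {x : S} (hx : x ∈ A) :
    green p x z * green p y y = green p x y * green p y z := by
  have hM : 0 < (1 - ρ)⁻¹ := inv_pos.mpr (by linarith)
  have gn := green_nonneg hp0 hp_zero hl hρ hρ1 hφ
  refine le_antisymm ?_ (green_B hp0 hp_zero hl hl1 hρ hρ1 hφ x y z)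
  set v : S → ℝ := fun x => if x ∈ A then
    max (green p x z * green p y y - green p x y * green p y z) 0 else 0 with hvdef
  have hv0 : ∀ x, 0 ≤ v x := fun x => by
    simp only [hvdef]; split_ifs
    · exact le_max_right _ _
    · exact le_rfl
  have h : v x ≤ 0 := by
    apply sub_zero_of hp0 hp_zero hl hρ hρ1 hφ (C := (1 - ρ)⁻¹ * (1 - ρ)⁻¹) (by positivity) z
    · intro x
      have hn : 0 ≤ ∑ w ∈ G.neighborFinset x, p x w * v w :=
        Finset.sum_nonneg fun w _ => mul_nonneg (hp0 _ _) (hv0 _)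
      by_cases hxA : x ∈ A
      swap
      · simp only [hvdef, hxA, if_false]; simpa [hvdef] using hn
      have hvx : v x = max (green p x z * green p y y - green p x y * green p y z) 0 := by
        simp only [hvdef, hxA, if_true]
      rw [hvx]
      apply max_le _ hn
      by_cases hxy : x = y
      · subst hxy; rw [mul_comm, sub_self]; exact hn
      · have e1 := green_eq hp0 hp_zero hl hρ hρ1 hφ x y
        have e2 := green_eq hp0 hp_zero hl hρ hρ1 hφ x z
        rw [if_neg hxy, zero_add] at e1
        rw [if_neg (by rintro rfl; exact hz hxA), zero_add] at e2
        calc green p x z * green p y y - green p x y * green p y z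
            = ∑ w ∈ G.neighborFinset x,
              p x w * (green p w z * green p y y - green p w y * green p y z) := by
              rw [e1, e2, Finset.sum_mul, Finset.sum_mul, ← Finset.sum_sub_distrib]
              exact Finset.sum_congr rfl fun w _ => by ring
          _ ≤ _ := Finset.sum_le_sum fun w hw => by
              apply mul_le_mul_of_nonneg_left _ (hp0 _ _)
              rcases hA x hxA w (by simpa using hw) with h | h
              · simp only [hvdef, h, if_true]; exact le_max_left _ _
              · subst h; rw [mul_comm, sub_self]; exact hv0 _
    · intro x
      simp only [hvdef]
      split_ifs
      swap
      · positivity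
      apply max_le _ (by positivity)
      have h1 := green_le hp0 hp_zero hl hρ hρ1 hφ x z
      have h2 := green_le' hp0 hp_zero hl hl1 hρ hρ1 hφ y y
      have := mul_le_mul h1 h2 (gn y y) (by positivity)
      have := mul_nonneg (gn x y) (gn y z)
      nlinarith
  have h1 := le_max_left (green p x z * green p y y - green p x y * green p y z) 0
  simp only [hvdef, hx, if_true] at h
  linarith

include hconn in
lemma green_lower {ε : ℝ} (hε : 0 < ε) (hH : ∀ x y, G.Adj x y → ε ≤ p x y) (x y : S) :
    ε ^ G.dist x y ≤ green p x y := by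
  have gn := green_nonneg hp0 hp_zero hl hρ hρ1 hφ
  have hs : ∀ x, 0 ≤ ∑ z ∈ G.neighborFinset x, p x z * green p z y := fun x =>
    Finset.sum_nonneg fun z _ => mul_nonneg (hp0 _ _) (gn _ _)
  induction hd : G.dist x y generalizing x with
  | zero =>
    have : x = y := (hconn.dist_eq_zero_iff).mp hd
    subst this
    rw [green_eq hp0 hp_zero hl hρ hρ1 hφ, if_pos rfl, pow_zero]
    have := hs x
    linarith
  | succ d ih =>
    have hne : x ≠ y := by rintro rfl; simp at hd
    obtain ⟨a, ha, had⟩ := exists_closer hconn hne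
    have h1 := ih a (by omega)
    rw [green_eq hp0 hp_zero hl hρ hρ1 hφ, if_neg hne, zero_add, pow_succ']
    calc ε * ε ^ d ≤ p x a * green p a y :=
          mul_le_mul (hH x a ha) h1 (by positivity) (hp0 _ _)
      _ ≤ _ := Finset.single_le_sum (f := fun z => p x z * green p z y)
          (fun z _ => mul_nonneg (hp0 _ _) (gn _ _)) (by simpa using ha)

section ray2
variable (hacyc : G.IsAcyclic) {γ : ℕ → S}
    (hγ : ∀ m n : ℕ, (G.dist (γ m) (γ n) : ℤ) = |(m : ℤ) - (n : ℤ)|)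
    {k : S → ℕ}
    (hk_min : ∀ (x : S) (n : ℕ), G.dist x (γ (k x)) ≤ G.dist x (γ n))
    (hk_uniq : ∀ (x : S) (n : ℕ), G.dist x (γ n) ≤ G.dist x (γ (k x)) → n = k x)
    {ε : ℝ} (hε : 0 < ε) (hε1 : ε ≤ 1) (hH : ∀ x y, G.Adj x y → ε ≤ p x y)
include hconn hacyc hγ hk_min hk_uniq

lemma green_ray {x z : S} {m : ℕ} (hx : k x ≤ m) (hz : m < k z) :
    green p x z * green p (γ m) (γ m) = green p x (γ m) * green p (γ m) z := by
  by_cases hxm : x = γ m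
  · subst hxm; ring
  refine green_A hp0 hp_zero hl hl1 hρ hρ1 hφ (A := {w | k w ≤ m ∧ w ≠ γ m})
    (fun h => by have := h.1; omega) ?_ ⟨hx, hxm⟩
  rintro w ⟨h1, h2⟩ w' hw
  by_cases hw' : w' = γ m
  · exact Or.inr hw'
  · refine Or.inl ⟨?_, hw'⟩
    by_contra hc
    exact h2 (side_cross hconn hacyc hγ hk_min hk_uniq hw h1 hc)

include hε hH

lemma green_pos (x y : S) : 0 < green p x y :=
  lt_of_lt_of_le (pow_pos hε _)
    (green_lower hconn hp0 hp_zero hl hl1 hρ hρ1 hφ hε hH x y)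

lemma K_eq {o : S} (ho : k o = 0) {x y : S} (hxy : k x < k y) :
    green p x y / green p o y = green p x (γ (k x)) / green p o (γ (k x)) := by
  have gp := green_pos hconn hp0 hp_zero hl hl1 hρ hρ1 hφ hacyc hγ hk_min hk_uniq hε hH
  have e1 := green_ray hconn hp0 hp_zero hl hl1 hρ hρ1 hφ hacyc hγ hk_min hk_uniq
    (x := x) (z := y) (m := k x) le_rfl hxy
  have e2 := green_ray hconn hp0 hp_zero hl hl1 hρ hρ1 hφ hacyc hγ hk_min hk_uniq
    (x := o) (z := y) (m := k x) (by omega) hxy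
  rw [div_eq_div_iff (gp _ _).ne' (gp _ _).ne']
  apply mul_right_cancel₀ (gp (γ (k x)) (γ (k x))).ne'
  linear_combination green p o (γ (k x)) * e1 - green p x (γ (k x)) * e2

include hε1

lemma K_le {o : S} (ho : k o = 0) {c : ℕ} {y : S} (hy : G.dist y (γ (k y)) ≤ c) (x : S) :
    green p x y / green p o y ≤
      (1 + ((1 - ρ)⁻¹ / ε ^ c) ^ 2) * (green p x (γ (k x)) / green p o (γ (k x))) := by
  have gp := green_pos hconn hp0 hp_zero hl hl1 hρ hρ1 hφ hacyc hγ hk_min hk_uniq hε hH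
  have hM : 0 < (1 - ρ)⁻¹ := inv_pos.mpr (by linarith)
  set D := (1 - ρ)⁻¹ / ε ^ c with hD
  have hDpos : 0 < D := by positivity
  rcases Nat.lt_or_ge (k x) (k y) with h | h
  · rw [K_eq hconn hp0 hp_zero hl hl1 hρ hρ1 hφ hacyc hγ hk_min hk_uniq hε hH ho h]
    have := div_pos (gp x (γ (k x))) (gp o (γ (k x)))
    nlinarith [mul_pos (pow_pos hDpos 2) this]
  · set g := γ (k y) with hg
    set m := γ (k x) with hm
    have B := green_B hp0 hp_zero hl hl1 hρ hρ1 hφ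
    have lo := green_lower hconn hp0 hp_zero hl hl1 hρ hρ1 hφ hε hH
    have up := green_le' hp0 hp_zero hl hl1 hρ hρ1 hφ
    have hmD : D * ε ^ c = (1 - ρ)⁻¹ := by rw [hD]; field_simp
    have l1 : ε ^ c ≤ green p y g := le_trans (pow_le_pow_of_le_one hε.le hε1 hy) (lo _ _)
    have l2 : ε ^ c ≤ green p g y := by
      refine le_trans (pow_le_pow_of_le_one hε.le hε1 ?_) (lo _ _)
      rwa [SimpleGraph.dist_comm]
    have i1 : green p y y ≤ D * green p y g := by
      have := up y y
      nlinarith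
    have i2 : green p g g ≤ D * green p g y := by
      have := up g g
      nlinarith
    have j1 : green p x y ≤ D * green p x g := by
      have := B x y g
      have h3 := mul_le_mul_of_nonneg_left i1 (gp x g).le
      refine le_of_mul_le_mul_right ?_ (gp y g)
      linarith
    have j2 : green p o g ≤ D * green p o y := by
      have := B o g y
      have h3 := mul_le_mul_of_nonneg_left i2 (gp o y).le
      refine le_of_mul_le_mul_right ?_ (gp g y)
      linarith
    have j4 : green p o m * green p g g = green p o g * green p g m := by
      rcases Nat.lt_or_ge (k y) (k x) with h' | h'
      · exact green_ray hconn hp0 hp_zero hl hl1 hρ hρ1 hφ hacyc hγ hk_min hk_uniq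
          (x := o) (z := m) (m := k y) (by omega)
          (by rw [hm, k_ray hconn hacyc hγ hk_min hk_uniq]; exact h')
      · have : g = m := by rw [hg, hm, le_antisymm h h']
        rw [this]
    have j3 : green p x g * green p o m ≤ green p x m * green p o g := by
      have := B x g m
      refine le_of_mul_le_mul_right ?_ (gp g g)
      have h5 := mul_le_mul_of_nonneg_left this (gp o g).le
      calc green p x g * green p o m * green p g g
          = green p x g * (green p o m * green p g g) := by ring
        _ = green p o g * (green p x g * green p g m) := by rw [j4]; ring
        _ ≤ _ := by linarith
    rw [mul_div_assoc', div_le_div_iff₀ (gp _ _) (gp _ _)]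
    calc green p x y * green p o m ≤ D * green p x g * green p o m :=
          mul_le_mul_of_nonneg_right j1 (gp _ _).le
      _ = D * (green p x g * green p o m) := by ring
      _ ≤ D * (green p x m * green p o g) := mul_le_mul_of_nonneg_left j3 hDpos.le
      _ ≤ D * (green p x m * (D * green p o y)) := by
          gcongr; exact (gp _ _).le
      _ = D ^ 2 * green p x m * green p o y := by ring
      _ ≤ _ := by
          have := mul_pos (gp x m) (gp o y)
          nlinarith

end ray2
end green

section final
variable {S : Type*}

lemma lt_exit_iff (U : Set S) (ω : ℕ → S) (n : ℕ) :
    (n : ℕ∞) < exitTime U ω ↔ ∀ j ≤ n, ω j ∈ U := by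
  constructor
  · intro h j hj
    by_contra hc
    have h1 : exitTime U ω ≤ (j : ℕ∞) := iInf₂_le j hc
    have h2 : (j : ℕ∞) ≤ n := by exact_mod_cast hj
    exact absurd (lt_of_lt_of_le h (h1.trans h2)) (lt_irrefl _)
  · intro h
    have : ((n + 1 : ℕ) : ℕ∞) ≤ exitTime U ω := by
      refine le_iInf₂ fun j hj => ?_
      have : n + 1 ≤ j := by
        by_contra hc
        exact hj (h j (by omega))
      exact_mod_cast this
    refine lt_of_lt_of_le ?_ this
    exact_mod_cast Nat.lt_succ_self n

lemma exit_top_iff (U : Set S) (ω : ℕ → S) : exitTime U ω = ⊤ ↔ ∀ j, ω j ∈ U := by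
  constructor
  · intro h j
    exact (lt_exit_iff U ω j).mp (by rw [h]; exact ENat.coe_lt_top j) j le_rfl
  · intro h
    rw [exitTime]
    simp [h]

lemma exit_prob [Countable S] [MeasurableSpace S] [MeasurableSingletonClass S]
    (U : Set S) (r : S → S → ℝ≥0∞) (Q : Measure (ℕ → S)) [IsProbabilityMeasure Q] (o : S)
    (hQ0 : Q {ω | ω 0 = o} = 1)
    (hQ : ∀ n (f : ℕ → S), Q {ω | ∀ j ≤ n + 1, ω j = f j} =
      Q {ω | ∀ j ≤ n, ω j = f j} * r (f n) (f (n + 1))) :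
    Q {ω | exitTime U ω = ⊤} + ∑' w : S, (if w ∈ U then 0 else ∑' n, T U r n o w) = 1 := by
  have hUm : ∀ j, MeasurableSet {ω : ℕ → S | ω j ∈ U} := fun j =>
    measurable_pi_apply j (Set.to_countable U).measurableSet
  have hmeas : MeasurableSet {ω : ℕ → S | exitTime U ω = ⊤} := by
    simp only [exit_top_iff, Set.ofPred_forall]
    exact MeasurableSet.iInter fun j => hUm j
  rw [← prob_add_prob_compl (μ := Q) hmeas]
  congr 1
  have hset : {ω : ℕ → S | exitTime U ω = ⊤}ᶜ = ⋃ q : S × ℕ,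
      (if q.1 ∈ U then ∅ else {ω | (∀ j < q.2, ω j ∈ U) ∧ ω q.2 = q.1}) := by
    ext ω
    simp only [Set.mem_compl_iff, Set.mem_ofPred_eq, exit_top_iff, Set.mem_iUnion]
    constructor
    · intro h
      push Not at h
      refine ⟨(ω (Nat.find h), Nat.find h), ?_⟩
      rw [if_neg (Nat.find_spec h)]
      exact ⟨fun j hj => not_not.mp (Nat.find_min h hj), rfl⟩
    · rintro ⟨⟨w, n⟩, h⟩ hall
      split_ifs at h with hw
      · exact h
      · exact hw (by have := h.2; simp only at this; rw [← this]; exact hall n)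
  rw [hset, measure_iUnion]
  · rw [ENNReal.tsum_prod']
    congr 1
    ext w
    by_cases hw : w ∈ U
    · simp [hw]
    · simp only [hw, if_false]
      congr 1
      ext n
      rw [path_T U r Q o hQ0 hQ]
  · rintro ⟨w, n⟩ ⟨w', n'⟩ hne
    rw [Function.onFun, Set.disjoint_left]
    intro ω h h'
    simp only at h h'
    split_ifs at h with hw
    · exact h
    split_ifs at h' with hw'
    · exact h'
    obtain ⟨h1, h2⟩ := h
    obtain ⟨h1', h2'⟩ := h'
    rcases lt_trichotomy n n' with hlt | heq | hlt
    · exact hw (h2 ▸ h1' n hlt)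
    · subst heq; exact hne (by rw [← h2, ← h2'])
    · exact hw' (h2' ▸ h1 n' hlt)
  · rintro ⟨w, n⟩
    simp only
    split_ifs
    · exact MeasurableSet.empty
    · refine MeasurableSet.inter ?_ (measurableSet_eq_fun (measurable_pi_apply n) measurable_const)
      show MeasurableSet {ω : ℕ → S | ∀ j < n, ω j ∈ U}
      simp only [Set.ofPred_forall]
      exact MeasurableSet.iInter fun j => MeasurableSet.iInter fun _ => hUm _

lemma cyl_step (r : S → S → ℝ) (hr : ∀ x y, 0 ≤ r x y) [MeasurableSpace S]
    (Q : Measure (ℕ → S)) (o : S)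
    (hQ : ∀ (n : ℕ) (f : ℕ → S), Q {ω | ∀ j ≤ n, ω j = f j} =
        ENNReal.ofReal ((if f 0 = o then 1 else 0) * ∏ j ∈ Finset.range n, r (f j) (f (j + 1)))) :
    Q {ω | ω 0 = o} = 1 ∧ ∀ n (f : ℕ → S), Q {ω | ∀ j ≤ n + 1, ω j = f j} =
      Q {ω | ∀ j ≤ n, ω j = f j} * ENNReal.ofReal (r (f n) (f (n + 1))) := by
  constructor
  · simpa using hQ 0 (fun _ => o)
  · intro n f
    rw [hQ, hQ, Finset.prod_range_succ, ← mul_assoc, ENNReal.ofReal_mul]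
    apply mul_nonneg
    · split_ifs <;> norm_num
    · exact Finset.prod_nonneg fun _ _ => hr _ _

end final
end RatioAux
open RatioAux

/-- Under hypothesis (H), for a geodesic ray `γ` from `o`,
`c ∈ ℕ`, the non-tangential tube `Γ_c = {x | ∃ n, d(x,γ n) ≤ c}`, a set
`U ⊇ Γ_c` with exit time `τ`, and `G_U(o,y) = ∑_n P_o[X_n = y, n < τ]`: for
every sequence `(y_j)` in `Γ_c` with `d(o,y_j) → ∞`, the ratios
`G_U(o,y_j)/G(o,y_j)` converge to `P^K_o[τ = ∞]`, where `P^K_o` is the law of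
the Doob-transformed chain started at `o`. -/
theorem ratio_tendsto_survival_probability
    {S : Type*} [Countable S] [MeasurableSpace S] [MeasurableSingletonClass S]
    (G : SimpleGraph S) [∀ x : S, Fintype (G.neighborSet x)]
    (hconn : G.Connected) (hacyc : G.IsAcyclic)
    (p : S → S → ℝ)
    (hp_pos : ∀ x y, 0 < p x y ↔ G.Adj x y)
    (hp_zero : ∀ x y, ¬ G.Adj x y → p x y = 0)
    (hp_sum : ∀ x, ∑ y ∈ G.neighborFinset x, p x y = 1)
    (ε η : ℝ) (hε : 0 < ε) (hη : 0 < η)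
    (hH : ∀ x y, G.Adj x y → ε ≤ p x y ∧ p x y ≤ 1 / 2 - η)
    (o : S) (γ : ℕ → S) (hγ0 : γ 0 = o)
    (hγ : ∀ m n : ℕ, (G.dist (γ m) (γ n) : ℤ) = |(m : ℤ) - (n : ℤ)|)
    (k : S → ℕ)
    (hk_min : ∀ (x : S) (n : ℕ), G.dist x (γ (k x)) ≤ G.dist x (γ n))
    (hk_uniq : ∀ (x : S) (n : ℕ), G.dist x (γ n) ≤ G.dist x (γ (k x)) → n = k x)
    (K : S → ℝ) (hK : ∀ x, K x = green p x (γ (k x)) / green p o (γ (k x)))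
    (P : S → Measure (ℕ → S)) (hPprob : ∀ x, IsProbabilityMeasure (P x))
    (hP : ∀ (x : S) (n : ℕ) (f : ℕ → S),
      P x {ω | ∀ j ≤ n, ω j = f j} =
        ENNReal.ofReal ((if f 0 = x then 1 else 0) *
          ∏ j ∈ Finset.range n, p (f j) (f (j + 1))))
    (PK : Measure (ℕ → S)) (hPKprob : IsProbabilityMeasure PK)
    (hPK : ∀ (n : ℕ) (f : ℕ → S),
      PK {ω | ∀ j ≤ n, ω j = f j} =
        ENNReal.ofReal ((if f 0 = o then 1 else 0) *
          ∏ j ∈ Finset.range n, (p (f j) (f (j + 1)) * K (f (j + 1)) / K (f j))))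
    (c : ℕ) (U : Set S)
    (hU : {x : S | ∃ n : ℕ, G.dist x (γ n) ≤ c} ⊆ U)
    (y : ℕ → S) (hy : ∀ j, ∃ n : ℕ, G.dist (y j) (γ n) ≤ c)
    (hyd : Tendsto (fun j => G.dist o (y j)) atTop atTop) :
    Tendsto
      (fun j =>
        (∑' n : ℕ, (P o {ω | ω n = y j ∧ (n : ℕ∞) < exitTime U ω}).toReal) /
          green p o (y j))
      atTop (𝓝 ((PK {ω | exitTime U ω = ⊤}).toReal)) := by
  have hp0 : ∀ x y, 0 ≤ p x y := fun x y => by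
    by_cases h : G.Adj x y
    · exact ((hp_pos x y).mpr h).le
    · rw [hp_zero x y h]
  have hadj := ray_adj hconn hacyc hγ 0
  have hη' : η < 1 / 2 := by have := hH _ _ hadj; linarith
  have hε1 : ε ≤ 1 := by have := hH _ _ hadj; linarith
  obtain ⟨l, ρ, hl, hl1, hρ, hρ1, hφ⟩ := phi_exists hconn hacyc hp_sum hη hη'
    (fun x y h => (hH x y h).2)
  have hHε : ∀ x y, G.Adj x y → ε ≤ p x y := fun x y h => (hH x y h).1
  have gp := green_pos hconn hp0 hp_zero hl hl1 hρ hρ1 hφ hacyc hγ hk_min hk_uniq hε hHε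
  have ho : k o = 0 := by rw [← hγ0]; exact k_ray hconn hacyc hγ hk_min hk_uniq 0
  have hKpos : ∀ x, 0 < K x := fun x => by rw [hK]; exact div_pos (gp _ _) (gp _ _)
  have hKo : K o = 1 := by rw [hK]; exact div_self (gp _ _).ne'
  have hyU : ∀ j, y j ∈ U := fun j => hU (hy j)
  have hyc : ∀ j, G.dist (y j) (γ (k (y j))) ≤ c := fun j => by
    obtain ⟨n, hn⟩ := hy j
    exact (hk_min _ n).trans hn
  have hky : Tendsto (fun j => k (y j)) atTop atTop := by
    rw [tendsto_atTop] at hyd ⊢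
    intro b
    filter_upwards [hyd (b + c)] with j hj
    have h1 : G.dist o (y j) ≤ G.dist o (γ (k (y j))) + G.dist (γ (k (y j))) (y j) :=
      hconn.dist_triangle
    have h2 : G.dist o (γ (k (y j))) = k (y j) := by
      have := hγ 0 (k (y j))
      rw [hγ0] at this
      simp at this
      exact this
    have h3 := hyc j
    rw [SimpleGraph.dist_comm] at h3
    omega
  -- the two chains
  set r : S → S → ℝ≥0∞ := fun a b => ENNReal.ofReal (p a b) with hr
  obtain ⟨hP0, hP1⟩ := cyl_step p hp0 (P o) o (hP o)
  obtain ⟨hPK0, hPK1⟩ := cyl_step (fun a b => p a b * K b / K a)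
    (fun a b => div_nonneg (mul_nonneg (hp0 _ _) (hKpos _).le) (hKpos _).le) PK o hPK
  haveI := hPprob o
  set h : S → ℝ≥0∞ := fun w => if w ∈ U then 0 else ∑' n, T U r n o w with hh
  have hexit := exit_prob U (fun a b => ENNReal.ofReal (p a b * K b / K a)) PK o hPK0 hPK1
  have hdoob : ∀ n w, T U (fun a b => ENNReal.ofReal (p a b * K b / K a)) n o w =
      T U r n o w * ENNReal.ofReal (K w) := by
    intro n w
    rw [T_doob U r _ (fun a => ENNReal.ofReal (K a)) (fun x => by simpa using hKpos x)
      (fun x => ENNReal.ofReal_ne_top) (fun a b => ?_), hKo, ENNReal.ofReal_one, div_one]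
    rw [ENNReal.ofReal_div_of_pos (hKpos a), ENNReal.ofReal_mul (hp0 _ _)]
  have hexit2 : PK {ω | exitTime U ω = ⊤} + ∑' w : S, h w * ENNReal.ofReal (K w) = 1 := by
    rw [← hexit]
    congr 2
    ext w
    simp only [hh]
    split_ifs
    · simp
    · simp_rw [hdoob]; rw [ENNReal.tsum_mul_right]
  have hsum_ne : ∑' w : S, h w * ENNReal.ofReal (K w) ≠ ⊤ := by
    intro hc; rw [hc] at hexit2; simp at hexit2
  have hh_ne : ∀ w, h w ≠ ⊤ := by
    intro w hc
    have := ENNReal.ne_top_of_tsum_ne_top hsum_ne w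
    rw [hc, ENNReal.top_mul (by simpa using hKpos w)] at this
    exact this rfl
  have hKR : ∀ w, (h w * ENNReal.ofReal (K w)).toReal = (h w).toReal * K w := fun w => by
    rw [ENNReal.toReal_mul, ENNReal.toReal_ofReal (hKpos w).le]
  have hsummable : Summable (fun w => (h w).toReal * K w) := by
    have := ENNReal.summable_toReal hsum_ne
    simpa only [hKR] using this
  have hlim : (PK {ω | exitTime U ω = ⊤}).toReal = 1 - ∑' w, (h w).toReal * K w := by
    have := congrArg ENNReal.toReal hexit2
    rw [ENNReal.toReal_add (measure_ne_top _ _) hsum_ne,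
      ENNReal.tsum_toReal_eq (ENNReal.ne_top_of_tsum_ne_top hsum_ne)] at this
    simp only [hKR, ENNReal.toReal_one] at this
    linarith
  have hratio : ∀ j, (∑' n : ℕ, (P o {ω | ω n = y j ∧ (n : ℕ∞) < exitTime U ω}).toReal) /
      green p o (y j) = 1 - ∑' w, (h w).toReal * (green p w (y j) / green p o (y j)) := by
    intro j
    have hset : ∀ n : ℕ, P o {ω | ω n = y j ∧ (n : ℕ∞) < exitTime U ω} = T U r n o (y j) := by
      intro n
      rw [← path_T U r (P o) o hP0 hP1]
      congr 1
      ext ω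
      simp only [Set.mem_ofPred_eq, lt_exit_iff]
      constructor
      · rintro ⟨h1, h2⟩
        exact ⟨fun j hj => h2 j hj.le, h1⟩
      · rintro ⟨h1, h2⟩
        refine ⟨h2, fun i hi => ?_⟩
        rcases hi.lt_or_eq with hi | rfl
        · exact h1 i hi
        · rw [h2]; exact hyU j
    have hg := fun x => ofReal_green hp0 hp_zero hl hρ hρ1 hφ x (y j)
    have hdec := green_decomp U r (hyU j) o
    rw [← hg o] at hdec
    have hfin : ENNReal.ofReal (green p o (y j)) ≠ ⊤ := ENNReal.ofReal_ne_top
    rw [hdec] at hfin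
    obtain ⟨hf1, hf2⟩ := ENNReal.add_ne_top.mp hfin
    have hreal := congrArg ENNReal.toReal hdec
    rw [ENNReal.toReal_ofReal (gp _ _).le, ENNReal.toReal_add hf1 hf2,
      ENNReal.tsum_toReal_eq (ENNReal.ne_top_of_tsum_ne_top hf1),
      ENNReal.tsum_toReal_eq (ENNReal.ne_top_of_tsum_ne_top hf2)] at hreal
    simp_rw [hset]
    have e : ∀ w, ((if w ∈ U then 0 else ∑' n, T U r n o w) *
        ∑' n, T Set.univ r n w (y j)).toReal = (h w).toReal * green p w (y j) := by
      intro w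
      rw [← hg w, ENNReal.toReal_mul, ENNReal.toReal_ofReal (gp _ _).le]
    simp_rw [e] at hreal
    simp_rw [← mul_div_assoc]
    rw [tsum_div_const, eq_sub_iff_add_eq, ← add_div, ← hreal, div_self (gp _ _).ne']
  simp_rw [hratio]
  rw [hlim]
  refine Tendsto.const_sub 1 ?_
  refine tendsto_tsum_of_dominated_convergence
    (bound := fun w => (1 + ((1 - ρ)⁻¹ / ε ^ c) ^ 2) * ((h w).toReal * K w))
    (hsummable.mul_left _) ?_ ?_
  · intro w
    apply tendsto_const_nhds.congr'
    filter_upwards [hky.eventually_gt_atTop (k w)] with j hj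
    rw [K_eq hconn hp0 hp_zero hl hl1 hρ hρ1 hφ hacyc hγ hk_min hk_uniq hε hHε ho hj, hK]
  · refine Eventually.of_forall fun j w => ?_
    rw [Real.norm_of_nonneg (mul_nonneg ENNReal.toReal_nonneg (div_pos (gp _ _) (gp _ _)).le)]
    have := K_le hconn hp0 hp_zero hl hl1 hρ hρ1 hφ hacyc hγ hk_min hk_uniq hε hε1 hHε ho
      (hyc j) w
    rw [← hK] at this
    calc _ ≤ (h w).toReal * ((1 + ((1 - ρ)⁻¹ / ε ^ c) ^ 2) * K w) :=
          mul_le_mul_of_nonneg_left this ENNReal.toReal_nonneg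
      _ = _ := by ring

end
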